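/- Fix an integer $n\ge 2$, positive integers $e_1,\dots,e_{n-1}$, and indices $1\le i<j\le n-1$. For each prime $p$, let $N(p)$ be the number of tuples of integers $(a_{rs})$, indexed by the pairs $\{(r,s): 1\le r<s\le i\}\cup\{(r,j): 1\le r\le i\}$, with $0\le a_{rs}<p^{e_r-1}$, such that the componentwise product $v_i\circ v_j$ lies in the $\mathbb{Z}$-span of the columns of the associated matrix $A$. Then there exists a polynomial $P$ with rational coefficients such that $N(p)=P(p)$ for every prime $p$. -/

import Mathlib

/-- The `(m+1) × (m+1)` integer matrix associated to a prime `p`, composition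
`e = (e₁, …, e_m)` of positive integers, and a family of above-diagonal parameters
`a : Fin m → Fin m → ℤ`: it is upper triangular with diagonal `(p^{e₁}, …, p^{e_m}, 1)`,
last column `(1, …, 1)ᵀ`, and entry `p · a r s` in position `(r, s)` for `r < s < m`. -/
def assocMatrix (p : ℕ) {m : ℕ} (e : Fin m → ℕ) (a : Fin m → Fin m → ℤ) :
    Matrix (Fin (m + 1)) (Fin (m + 1)) ℤ :=
  Matrix.of fun r s =>
    if hs : (s : ℕ) = m then 1
    else if hrs : (r : ℕ) = (s : ℕ) then
      (p : ℤ) ^ e ⟨(s : ℕ), by have := s.isLt; omega⟩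
    else if hlt : (r : ℕ) < (s : ℕ) then
      (p : ℤ) * a ⟨(r : ℕ), by have := s.isLt; omega⟩ ⟨(s : ℕ), by have := s.isLt; omega⟩
    else 0

open Finset Polynomial

/-- The rational indicator of a proposition. -/
noncomputable def propInd (P : Prop) : ℚ := open Classical in if P then 1 else 0

theorem propInd_of_true {P : Prop} (h : P) : propInd P = 1 := by simp [propInd, h]

theorem propInd_of_false {P : Prop} (h : ¬P) : propInd P = 0 := by simp [propInd, h]

theorem propInd_and (P Q : Prop) : propInd (P ∧ Q) = propInd P * propInd Q := by
  by_cases hP : P <;> by_cases hQ : Q <;> simp [propInd, hP, hQ]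

theorem propInd_congr {P Q : Prop} (h : P ↔ Q) : propInd P = propInd Q := by rw [propext h]

/-- Summing over a product of finite sets by singling out one coordinate. -/
theorem sum_piFinset_eq_sum_update {ι κ M : Type*} [Fintype ι] [DecidableEq ι] [DecidableEq κ]
    [AddCommMonoid M] (T : ι → Finset κ) (i : ι) (z : κ) (F : (ι → κ) → M) :
    ∑ a ∈ Fintype.piFinset T, F a =
      ∑ v ∈ T i, ∑ a ∈ Fintype.piFinset (Function.update T i {z}),
        F (Function.update a i v) := by
  rw [← Finset.sum_product']
  refine Finset.sum_nbij' (fun a => (a i, Function.update a i z))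
    (fun q => Function.update q.2 i q.1) ?_ ?_ ?_ ?_ ?_
  · intro a ha
    rw [Fintype.mem_piFinset] at ha
    simp only [Finset.mem_product, Fintype.mem_piFinset]
    refine ⟨ha i, fun s => ?_⟩
    by_cases hs : s = i
    · subst hs; simp
    · simpa [hs] using ha s
  · rintro ⟨v, a⟩ h
    simp only [Finset.mem_product, Fintype.mem_piFinset] at h ⊢
    intro s
    by_cases hs : s = i
    · subst hs; simpa using h.1
    · simpa [hs] using h.2 s
  · intro a _
    simp
  · rintro ⟨v, a⟩ h
    simp only [Finset.mem_product, Fintype.mem_piFinset] at h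
    have := h.2 i
    simp only [Function.update_self, Finset.mem_singleton] at this
    simp [← this]
  · intro a _
    simp

/-- A quantity prescribed by the level at which a decreasing chain of conditions stops
is a linear combination of the indicators of these conditions. -/
theorem eq_sum_of_level (Q : ℕ → Prop) (h_anti : ∀ g, Q (g + 1) → Q g) (h_zero : Q 0) (K : ℕ)
    (V : ℕ → ℚ) (t : ℚ) (h_top : Q K → t = V K)
    (h_lt : ∀ g < K, Q g → ¬Q (g + 1) → t = V g) :
    t = V K * propInd (Q K) +
      ∑ g ∈ range K, V g * (propInd (Q g) - propInd (Q (g + 1))) := by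
  have key : ∑ g ∈ range K, V g * (propInd (Q g) - propInd (Q (g + 1))) =
      ∑ g ∈ range K, t * (propInd (Q g) - propInd (Q (g + 1))) := by
    refine Finset.sum_congr rfl fun g hg => ?_
    by_cases h1 : Q (g + 1)
    · simp [propInd, h1, h_anti g h1]
    · by_cases h2 : Q g
      · rw [h_lt g (Finset.mem_range.mp hg) h2 h1]
      · simp [propInd, h1, h2]
  rw [key, ← Finset.mul_sum, Finset.sum_range_sub', propInd_of_true h_zero]
  by_cases h : Q K
  · simp [propInd, h, h_top h]
  · simp [propInd, h]

theorem sum_Ico_propInd_dvd_sub {p : ℕ} (hp : p.Prime) {t d : ℕ} (htd : t ≤ d) (v : ℤ) :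
    ∑ a ∈ Finset.Ico (0 : ℤ) ((p : ℤ) ^ d), propInd ((p : ℤ) ^ t ∣ a - v) =
      (p : ℚ) ^ (d - t) := by
  have hpos : (0 : ℤ) < (p : ℤ) ^ t := by have := hp.pos; positivity
  have h := Int.Ico_filter_modEq_card 0 ((p : ℤ) ^ d) hpos v
  have hq : (((p : ℤ) ^ d : ℤ) - v : ℚ) / ((p : ℤ) ^ t : ℤ) =
      ((0 : ℤ) - v : ℚ) / ((p : ℤ) ^ t : ℤ) + ((p : ℤ) ^ (d - t) : ℤ) := by
    have hp0 : (p : ℚ) ≠ 0 := by exact_mod_cast hp.ne_zero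
    push_cast
    rw [← pow_mul_pow_sub (p : ℚ) htd]
    field_simp
    ring
  rw [hq, Int.ceil_add_intCast, add_sub_cancel_left, max_eq_left (by positivity)] at h
  have h2 : (∑ a ∈ Finset.Ico (0 : ℤ) ((p : ℤ) ^ d), propInd ((p : ℤ) ^ t ∣ a - v)) =
      ((#{x ∈ Finset.Ico (0 : ℤ) ((p : ℤ) ^ d) | x ≡ v [ZMOD (p : ℤ) ^ t]} : ℤ) : ℚ) := by
    rw [Finset.card_filter]
    push_cast
    refine Finset.sum_congr rfl fun a _ => ?_
    have : (p : ℤ) ^ t ∣ a - v ↔ a ≡ v [ZMOD (p : ℤ) ^ t] := by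
      rw [Int.modEq_comm, Int.modEq_iff_dvd]
    rw [propInd_congr this]
    unfold propInd
    congr
  rw [h2, h]
  push_cast
  rfl

theorem sum_Ico_propInd_dvd_sub_mul {p : ℕ} (hp : p.Prime) {t d : ℕ} (htd : t ≤ d) (w y : ℤ)
    (hy : ¬(p : ℤ) ∣ y) :
    ∑ a ∈ Finset.Ico (0 : ℤ) ((p : ℤ) ^ d), propInd ((p : ℤ) ^ t ∣ w - a * y) =
      (p : ℚ) ^ (d - t) := by
  have hco : IsCoprime ((p : ℤ) ^ t) y :=
    IsCoprime.pow_left ((Nat.prime_iff_prime_int.mp hp).coprime_iff_not_dvd.mpr hy)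
  obtain ⟨α, β, hαβ⟩ := hco
  rw [← sum_Ico_propInd_dvd_sub hp htd (w * β)]
  refine Finset.sum_congr rfl fun a _ => propInd_congr ?_
  have hco : IsCoprime ((p : ℤ) ^ t) y := ⟨α, β, hαβ⟩
  have : w - a * y = (p : ℤ) ^ t * (w * α) - (a - w * β) * y := by linear_combination (-w) * hαβ
  rw [this, dvd_sub_right (dvd_mul_right _ _)]
  exact ⟨fun h => hco.dvd_of_dvd_mul_right h, fun h => h.mul_right _⟩

theorem sum_Ico_propInd_dvd_sub_pow_mul {p : ℕ} (hp : p.Prime) {g K d : ℕ} (hgK : g ≤ K)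
    (hKd : K ≤ d + g) (w y : ℤ) (hy : ¬(p : ℤ) ∣ y) :
    ∑ a ∈ Finset.Ico (0 : ℤ) ((p : ℤ) ^ d), propInd ((p : ℤ) ^ K ∣ w - a * ((p : ℤ) ^ g * y)) =
      (p : ℚ) ^ (d - (K - g)) * propInd ((p : ℤ) ^ g ∣ w) := by
  have hp0 : (p : ℤ) ^ g ≠ 0 := pow_ne_zero _ (by exact_mod_cast hp.ne_zero)
  by_cases hw : (p : ℤ) ^ g ∣ w
  · obtain ⟨w, rfl⟩ := hw
    rw [propInd_of_true (dvd_mul_right _ _), mul_one,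
      ← sum_Ico_propInd_dvd_sub_mul hp (t := K - g) (by omega) w y hy]
    refine Finset.sum_congr rfl fun a _ => propInd_congr ?_
    rw [← pow_mul_pow_sub (p : ℤ) hgK, ← mul_dvd_mul_iff_left hp0 (b := (p : ℤ) ^ (K - g))]
    ring_nf
  · rw [propInd_of_false hw, mul_zero]
    refine Finset.sum_eq_zero fun a _ => propInd_of_false fun h => hw ?_
    have h1 : (p : ℤ) ^ g ∣ w - a * ((p : ℤ) ^ g * y) := (pow_dvd_pow _ hgK).trans h
    exact (dvd_sub_left ((dvd_mul_right _ _).mul_left _)).mp h1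

theorem card_piFinset_ite {ι : Type*} [Fintype ι] [DecidableEq ι] (I : Finset ι) (q : ℕ) :
    #(Fintype.piFinset fun s => if s ∈ I then Finset.Ico (0 : ℤ) q else {0}) = q ^ #I := by
  rw [Fintype.card_piFinset]
  have : ∀ s, #(if s ∈ I then Finset.Ico (0 : ℤ) q else {0}) = if s ∈ I then q else 1 := by
    intro s; split_ifs <;> simp
  simp [this, Finset.prod_ite_mem]

/-- The number of solutions of a linear congruence modulo `p ^ (d + l)` in a box, when the
coefficients are divisible by exactly `p ^ g`. -/
theorem sum_piFinset_propInd_of_level {ι : Type*} [Fintype ι] [DecidableEq ι] {p : ℕ}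
    (hp : p.Prime) (I : Finset ι) (d l : ℕ) (x : ι → ℤ) (z : ℤ)
    (hl : ∀ s ∈ I, (p : ℤ) ^ l ∣ x s) {g : ℕ} (hg : ∀ s ∈ I, (p : ℤ) ^ g ∣ x s)
    (h : g = d + l ∨ g < d + l ∧ ¬∀ s ∈ I, (p : ℤ) ^ (g + 1) ∣ x s) :
    ∑ α ∈ Fintype.piFinset (fun s => if s ∈ I then Finset.Ico (0 : ℤ) ((p : ℤ) ^ d) else {0}),
      propInd ((p : ℤ) ^ (d + l) ∣ z - ∑ s ∈ I, α s * x s) =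
      (p : ℚ) ^ (d * #I - (d + l - g)) * propInd ((p : ℤ) ^ g ∣ z) := by
  rcases h with rfl | ⟨hgK, hne⟩
  · have : ∀ α : ι → ℤ, propInd ((p : ℤ) ^ (d + l) ∣ z - ∑ s ∈ I, α s * x s) =
        propInd ((p : ℤ) ^ (d + l) ∣ z) := fun α =>
      propInd_congr (dvd_sub_left (Finset.dvd_sum fun s hs => (hg s hs).mul_left _))
    simp only [this, Finset.sum_const]
    have hc := card_piFinset_ite I (p ^ d)
    push_cast at hc
    rw [hc]
    simp [pow_mul]
  · push Not at hne
    obtain ⟨s₀, hs₀, hx⟩ := hne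
    obtain ⟨y, hy⟩ := hg s₀ hs₀
    have hlg : l ≤ g := by
      by_contra hlt
      exact hx ((pow_dvd_pow _ (by omega)).trans (hl s₀ hs₀))
    have hpy : ¬(p : ℤ) ∣ y := by
      rintro ⟨y', rfl⟩
      exact hx ⟨y', by rw [hy]; ring⟩
    rw [sum_piFinset_eq_sum_update _ s₀ 0, Finset.sum_comm]
    have hT : (Function.update
        (fun s => if s ∈ I then Finset.Ico (0 : ℤ) ((p : ℤ) ^ d) else {0}) s₀ {0}) =
        fun s => if s ∈ I.erase s₀ then Finset.Ico (0 : ℤ) ((p : ℤ) ^ d) else {0} := by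
      funext s
      by_cases hs : s = s₀
      · subst hs; simp
      · simp [hs]
    have hin : ∀ α : ι → ℤ, ∑ v ∈ (if s₀ ∈ I then Finset.Ico (0 : ℤ) ((p : ℤ) ^ d) else {0}),
        propInd ((p : ℤ) ^ (d + l) ∣ z - ∑ s ∈ I, Function.update α s₀ v s * x s) =
        (p : ℚ) ^ (d - (d + l - g)) * propInd ((p : ℤ) ^ g ∣ z) := by
      intro α
      rw [if_pos hs₀]
      have hdv : (p : ℤ) ^ g ∣ ∑ s ∈ I.erase s₀, α s * x s :=
        Finset.dvd_sum fun s hs => (hg s (Finset.mem_of_mem_erase hs)).mul_left _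
      rw [propInd_congr (dvd_sub_left hdv).symm,
        ← sum_Ico_propInd_dvd_sub_pow_mul hp hgK.le (by omega) _ y hpy]
      refine Finset.sum_congr rfl fun v _ => ?_
      rw [← Finset.add_sum_erase I _ hs₀, Function.update_self, hy]
      have : ∑ s ∈ I.erase s₀, Function.update α s₀ v s * x s =
          ∑ s ∈ I.erase s₀, α s * x s :=
        Finset.sum_congr rfl fun s hs => by
          rw [Function.update_of_ne (Finset.ne_of_mem_erase hs)]
      rw [this]
      congr 2
      ring
    simp only [hin, Finset.sum_const, hT]
    have hc := card_piFinset_ite (I.erase s₀) (p ^ d)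
    push_cast at hc
    rw [hc, Finset.card_erase_of_mem hs₀, nsmul_eq_mul, ← mul_assoc]
    push_cast
    rw [← pow_mul, ← pow_add]
    obtain ⟨N, hN⟩ : ∃ N, #I = N + 1 := ⟨#I - 1, by
      have := Finset.card_pos.mpr ⟨s₀, hs₀⟩; omega⟩
    rw [hN]
    congr 2
    simp only [Nat.add_sub_cancel, mul_add, mul_one]
    omega

/-- The positions below `E` at which the base `p` digit of `c` is zero. -/
def zeroDigits (E p c : ℕ) : Finset ℕ := (range E).filter fun t => c / p ^ t % p = 0

/-- `f p c` is, for `c < p ^ E`, a polynomial in the prime `p` depending only on the positions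
of the zero digits of `c`. -/
def IsDigitPoly (E : ℕ) (f : ℕ → ℕ → ℚ) : Prop :=
  ∃ G : Finset ℕ → ℚ[X], ∀ p : ℕ, p.Prime → ∀ c < p ^ E,
    f p c = (G (zeroDigits E p c)).eval (p : ℚ)

namespace IsDigitPoly

variable {E : ℕ} {f f' : ℕ → ℕ → ℚ}

theorem congr (hf : IsDigitPoly E f) (h : ∀ p : ℕ, p.Prime → ∀ c < p ^ E, f' p c = f p c) :
    IsDigitPoly E f' := by
  obtain ⟨G, hG⟩ := hf
  exact ⟨G, fun p hp c hc => (h p hp c hc).trans (hG p hp c hc)⟩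

theorem add (hf : IsDigitPoly E f) (hf' : IsDigitPoly E f') :
    IsDigitPoly E fun p c => f p c + f' p c := by
  obtain ⟨G, hG⟩ := hf
  obtain ⟨G', hG'⟩ := hf'
  exact ⟨fun Z => G Z + G' Z, fun p hp c hc => by simp [hG p hp c hc, hG' p hp c hc]⟩

theorem sub (hf : IsDigitPoly E f) (hf' : IsDigitPoly E f') :
    IsDigitPoly E fun p c => f p c - f' p c := by
  obtain ⟨G, hG⟩ := hf
  obtain ⟨G', hG'⟩ := hf'
  exact ⟨fun Z => G Z - G' Z, fun p hp c hc => by simp [hG p hp c hc, hG' p hp c hc]⟩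

theorem mul (hf : IsDigitPoly E f) (hf' : IsDigitPoly E f') :
    IsDigitPoly E fun p c => f p c * f' p c := by
  obtain ⟨G, hG⟩ := hf
  obtain ⟨G', hG'⟩ := hf'
  exact ⟨fun Z => G Z * G' Z, fun p hp c hc => by simp [hG p hp c hc, hG' p hp c hc]⟩

theorem prime_pow (E k : ℕ) : IsDigitPoly E fun p _ => (p : ℚ) ^ k :=
  ⟨fun _ => X ^ k, fun p _ c _ => by simp⟩

theorem zero (E : ℕ) : IsDigitPoly E fun _ _ => 0 := ⟨fun _ => 0, by simp⟩

theorem one (E : ℕ) : IsDigitPoly E fun _ _ => 1 := ⟨fun _ => 1, by simp⟩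

theorem sum {ι : Type*} (S : Finset ι) {f : ι → ℕ → ℕ → ℚ} (hf : ∀ t, IsDigitPoly E (f t)) :
    IsDigitPoly E fun p c => ∑ t ∈ S, f t p c := by
  choose G hG using hf
  refine ⟨fun Z => ∑ t ∈ S, G t Z, fun p hp c hc => ?_⟩
  rw [Polynomial.eval_finsetSum]
  exact Finset.sum_congr rfl fun t _ => hG t p hp c hc

end IsDigitPoly

theorem pow_dvd_div_pow_iff_zeroDigits {E p c : ℕ} (hp : p.Prime) (hc : c < p ^ E) (a t : ℕ) :
    p ^ a ∣ c / p ^ t ↔ ∀ s < a, t + s < E → t + s ∈ zeroDigits E p c := by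
  induction a generalizing t with
  | zero => simp
  | succ a ih =>
    have h1 : p ^ (a + 1) ∣ c / p ^ t ↔ p ∣ c / p ^ t ∧ p ^ a ∣ c / p ^ (t + 1) := by
      rw [pow_succ p t, ← Nat.div_div_eq_div_mul]
      constructor
      · rintro ⟨y, hy⟩
        rw [hy]
        refine ⟨⟨p ^ a * y, by ring⟩, ?_⟩
        rw [show p ^ (a + 1) * y = p * (p ^ a * y) by ring, Nat.mul_div_cancel_left _ hp.pos]
        exact dvd_mul_right _ _
      · rintro ⟨⟨y, hy⟩, h⟩
        rw [hy, Nat.mul_div_cancel_left _ hp.pos] at h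
        rw [hy, pow_succ']
        exact mul_dvd_mul_left _ h
    rw [h1, ih]
    have h0 : p ∣ c / p ^ t ↔ (t < E → t ∈ zeroDigits E p c) := by
      by_cases ht : t < E
      · simp [zeroDigits, ht, Nat.dvd_iff_mod_eq_zero]
      · have : c / p ^ t = 0 :=
          Nat.div_eq_of_lt (hc.trans_le (Nat.pow_le_pow_right hp.pos (by omega)))
        simp [this, ht]
    rw [h0]
    constructor
    · rintro ⟨h, h'⟩ s hs hE
      cases s with
      | zero => exact h hE
      | succ s =>
        have := h' s (by omega) (by omega)
        rwa [show t + 1 + s = t + (s + 1) by ring] at this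
    · intro h
      refine ⟨fun hE => h 0 (by omega) hE, fun s hs hE => ?_⟩
      have := h (s + 1) (by omega) (by omega)
      rwa [show t + (s + 1) = t + 1 + s by ring] at this

theorem isDigitPoly_propInd_dvd_div (E a t : ℕ) :
    IsDigitPoly E fun p c => propInd (p ^ a ∣ c / p ^ t) := by
  refine ⟨fun Z => C (propInd (∀ s < a, t + s < E → t + s ∈ Z)), fun p hp c hc => ?_⟩
  simp only [eval_C]
  rw [propInd_congr (pow_dvd_div_pow_iff_zeroDigits hp hc a t)]

theorem zeroDigits_succ {E p c : ℕ} (hp : p.Prime) (hc : c < p ^ E) {t : ℕ} (ht : t < p) :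
    zeroDigits (E + 1) p (c + p ^ E * t) =
      if t = 0 then insert E (zeroDigits E p c) else zeroDigits E p c := by
  have hlow : ∀ s < E, (c + p ^ E * t) / p ^ s % p = c / p ^ s % p := by
    intro s hs
    have h : p ^ E * t = p ^ s * (p * (p ^ (E - s - 1) * t)) := by
      rw [← mul_assoc, ← mul_assoc, ← pow_succ, ← pow_add]
      congr 2
      omega
    rw [h, Nat.add_mul_div_left _ _ (pow_pos hp.pos s), Nat.add_mul_mod_self_left]
  have htop : (c + p ^ E * t) / p ^ E % p = t := by
    rw [Nat.add_mul_div_left _ _ (pow_pos hp.pos E), Nat.div_eq_of_lt hc, zero_add,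
      Nat.mod_eq_of_lt ht]
  ext s
  have hm : s ∈ zeroDigits E p c ↔ s < E ∧ c / p ^ s % p = 0 := by simp [zeroDigits]
  have hm' : s ∈ zeroDigits (E + 1) p (c + p ^ E * t) ↔
      s < E + 1 ∧ (c + p ^ E * t) / p ^ s % p = 0 := by simp [zeroDigits]
  rw [hm']
  rcases lt_trichotomy s E with hs | rfl | hs
  · rw [hlow s hs]
    split_ifs
    · simp only [Finset.mem_insert, hm]; omega
    · simp only [hm]; omega
  · rw [htop]
    split_ifs with h
    · simp [h]
    · simp [hm, h]
  · split_ifs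
    · simp only [Finset.mem_insert, hm]; omega
    · simp only [hm]; omega

theorem sum_range_mul_eq (q p : ℕ) (hq : 0 < q) (F : ℕ → ℚ) :
    ∑ c ∈ range (q * p), F c = ∑ c ∈ range q, ∑ t ∈ range p, F (c + q * t) := by
  rw [← Finset.sum_product']
  refine Finset.sum_nbij' (fun c => (c % q, c / q)) (fun w => w.1 + q * w.2) ?_ ?_ ?_ ?_ ?_
  · intro c hc
    simp only [Finset.mem_range, Finset.mem_product] at hc ⊢
    exact ⟨Nat.mod_lt _ hq, Nat.div_lt_of_lt_mul hc⟩
  · rintro ⟨c, t⟩ h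
    simp only [Finset.mem_range, Finset.mem_product] at h ⊢
    nlinarith [h.1, h.2]
  · intro c _
    exact Nat.mod_add_div c q
  · rintro ⟨c, t⟩ h
    simp only [Finset.mem_range, Finset.mem_product] at h
    simp [Nat.mod_eq_of_lt h.1, Nat.add_mul_div_left _ _ hq, Nat.div_eq_of_lt h.1]
  · intro c _
    rw [Nat.mod_add_div]

theorem IsDigitPoly.exists_sum_eq_eval {E : ℕ} {f : ℕ → ℕ → ℚ} (hf : IsDigitPoly E f) :
    ∃ P : ℚ[X], ∀ p : ℕ, p.Prime → ∑ c ∈ range (p ^ E), f p c = P.eval (p : ℚ) := by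
  obtain ⟨G, hG⟩ := hf
  suffices h : ∃ P : ℚ[X], ∀ p : ℕ, p.Prime →
      ∑ c ∈ range (p ^ E), (G (zeroDigits E p c)).eval (p : ℚ) = P.eval (p : ℚ) by
    obtain ⟨P, hP⟩ := h
    refine ⟨P, fun p hp => ?_⟩
    rw [← hP p hp]
    exact Finset.sum_congr rfl fun c hc => hG p hp c (Finset.mem_range.mp hc)
  clear hG
  induction E generalizing G with
  | zero => exact ⟨G ∅, fun p _ => by simp [zeroDigits]⟩
  | succ E ih =>
    obtain ⟨P, hP⟩ := ih fun Z => G (insert E Z) + (X - 1) * G Z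
    refine ⟨P, fun p hp => ?_⟩
    rw [← hP p hp, pow_succ, sum_range_mul_eq _ _ (pow_pos hp.pos E)]
    refine Finset.sum_congr rfl fun c hc => ?_
    have hc := Finset.mem_range.mp hc
    obtain ⟨p', rfl⟩ : ∃ p', p = p' + 1 := ⟨p - 1, by have := hp.pos; omega⟩
    rw [Finset.sum_range_succ']
    have h0 := zeroDigits_succ hp hc hp.pos
    rw [if_pos rfl] at h0
    rw [h0]
    have : ∀ t ∈ range p', (G (zeroDigits (E + 1) (p' + 1) (c + (p' + 1) ^ E * (t + 1)))).eval
        ((p' + 1 : ℕ) : ℚ) = (G (zeroDigits E (p' + 1) c)).eval ((p' + 1 : ℕ) : ℚ) := by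
      intro t ht
      have ht := Finset.mem_range.mp ht
      rw [zeroDigits_succ hp hc (t := t + 1) (by omega), if_neg (by omega)]
    rw [Finset.sum_congr rfl this]
    simp
    ring

theorem isDigitPoly_sum_propInd_dvd_sub (E d h : ℕ) :
    IsDigitPoly E fun p c => ∑ b ∈ Finset.Ico (0 : ℤ) ((p : ℤ) ^ d),
      propInd ((p : ℤ) ^ h ∣ b - (c : ℤ)) := by
  rcases le_or_gt h d with hd | hd
  · exact (IsDigitPoly.prime_pow E (d - h)).congr fun p hp c _ =>
      sum_Ico_propInd_dvd_sub hp hd c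
  · refine (isDigitPoly_propInd_dvd_div E (h - d) d).congr fun p hp c _ => ?_
    have hpos : (0 : ℤ) < (p : ℤ) ^ d := by have := hp.pos; positivity
    have hmod : ((c : ℤ) % (p : ℤ) ^ d) ∈ Finset.Ico (0 : ℤ) ((p : ℤ) ^ d) :=
      Finset.mem_Ico.mpr ⟨Int.emod_nonneg _ hpos.ne', Int.emod_lt_of_pos _ hpos⟩
    rw [Finset.sum_eq_single_of_mem _ hmod]
    · refine propInd_congr ?_
      have h1 : (c : ℤ) % (p : ℤ) ^ d - c = -((p : ℤ) ^ d * (c / (p : ℤ) ^ d)) := by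
        have := Int.emod_add_mul_ediv (c : ℤ) ((p : ℤ) ^ d)
        linarith
      rw [h1, dvd_neg, ← pow_mul_pow_sub (p : ℤ) hd.le,
        mul_dvd_mul_iff_left hpos.ne', ← Int.natCast_dvd_natCast]
      push_cast
      rfl
    · intro b hb hne
      refine propInd_of_false fun hdv => hne ?_
      have hb := Finset.mem_Ico.mp hb
      have h2 : (p : ℤ) ^ d ∣ b - c := (pow_dvd_pow _ hd.le).trans hdv
      rw [← Int.emod_eq_of_lt hb.1 hb.2]
      exact ((Int.modEq_iff_dvd).mpr h2).symm

/-- The number of pairs `(u, b)` in a box with `p ^ g ∣ p * u * (b - c)`. -/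
noncomputable def pairCount (d g p c : ℕ) : ℚ :=
  ∑ b ∈ Finset.Ico (0 : ℤ) ((p : ℤ) ^ d), ∑ u ∈ Finset.Ico (0 : ℤ) ((p : ℤ) ^ d),
    propInd ((p : ℤ) ^ g ∣ p * u * (b - c))

theorem sum_Ico_propInd_dvd_mul {p : ℕ} (hp : p.Prime) (d h : ℕ) (y : ℤ) :
    ∑ u ∈ Finset.Ico (0 : ℤ) ((p : ℤ) ^ d), propInd ((p : ℤ) ^ h ∣ u * y) =
      (p : ℚ) ^ (d - (h - h)) * propInd ((p : ℤ) ^ h ∣ y) +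
      ∑ g ∈ range h, (p : ℚ) ^ (d - (h - g)) *
        (propInd ((p : ℤ) ^ g ∣ y) - propInd ((p : ℤ) ^ (g + 1) ∣ y)) := by
  have hp0 : (p : ℤ) ≠ 0 := by exact_mod_cast hp.ne_zero
  refine eq_sum_of_level (fun g => (p : ℤ) ^ g ∣ y)
    (fun g hg => (pow_dvd_pow _ (by omega)).trans hg) (by simp) h
    (fun g => (p : ℚ) ^ (d - (h - g))) _ ?_ ?_
  · intro hy
    have : ∀ u : ℤ, propInd ((p : ℤ) ^ h ∣ u * y) = 1 := fun u =>
      propInd_of_true (hy.mul_left u)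
    simp only [this, Finset.sum_const, Int.card_Ico]
    rw [sub_zero, ← Nat.cast_pow, Int.toNat_natCast]
    simp
  · rintro g hg ⟨y, rfl⟩ hne
    have hy : ¬(p : ℤ) ∣ y := by
      rintro ⟨y', rfl⟩
      exact hne ⟨y', by ring⟩
    rcases le_or_gt h (d + g) with hd | hd
    · have := sum_Ico_propInd_dvd_sub_pow_mul hp hg.le hd 0 y hy
      rw [propInd_of_true (dvd_zero _), mul_one] at this
      rw [← this]
      refine Finset.sum_congr rfl fun u _ => propInd_congr ?_
      rw [zero_sub, dvd_neg]
    · have hpos : (0 : ℤ) < (p : ℤ) ^ d := by have := hp.pos; positivity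
      have h0 : (0 : ℤ) ∈ Finset.Ico (0 : ℤ) ((p : ℤ) ^ d) := by simp [hpos]
      rw [Finset.sum_eq_single_of_mem _ h0, zero_mul, propInd_of_true (dvd_zero _),
        show d - (h - g) = 0 by omega, pow_zero]
      intro u hu hu0
      refine propInd_of_false fun hdv => hu0 ?_
      rw [← pow_mul_pow_sub (p : ℤ) hg.le, mul_left_comm,
        mul_dvd_mul_iff_left (pow_ne_zero _ hp0)] at hdv
      have hco : IsCoprime ((p : ℤ) ^ (h - g)) y :=
        IsCoprime.pow_left ((Nat.prime_iff_prime_int.mp hp).coprime_iff_not_dvd.mpr hy)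
      have h1 : (p : ℤ) ^ d ∣ u :=
        (pow_dvd_pow _ (by omega)).trans (hco.dvd_of_dvd_mul_right hdv)
      have hu := Finset.mem_Ico.mp hu
      exact Int.eq_zero_of_dvd_of_nonneg_of_lt hu.1 hu.2 h1

theorem isDigitPoly_pairCount (E d g : ℕ) : IsDigitPoly E (pairCount d g) := by
  have hb : ∀ h, IsDigitPoly E fun p c => ∑ b ∈ Finset.Ico (0 : ℤ) ((p : ℤ) ^ d),
      propInd ((p : ℤ) ^ h ∣ p * (b - (c : ℤ))) := by
    intro h
    cases h with
    | zero =>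
      refine (IsDigitPoly.prime_pow E d).congr fun p _ c _ => ?_
      rw [Finset.sum_congr rfl fun b _ => propInd_of_true (by simp)]
      simp only [Finset.sum_const, Int.card_Ico]
      rw [sub_zero, ← Nat.cast_pow, Int.toNat_natCast]
      simp
    | succ h =>
      refine (isDigitPoly_sum_propInd_dvd_sub E d h).congr fun p hp c _ => ?_
      refine Finset.sum_congr rfl fun b _ => propInd_congr ?_
      rw [pow_succ', mul_dvd_mul_iff_left (by exact_mod_cast hp.ne_zero)]
  refine (((IsDigitPoly.prime_pow E (d - (g - g))).mul (hb g)).add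
    (IsDigitPoly.sum (range g) fun h =>
      (IsDigitPoly.prime_pow E (d - (g - h))).mul ((hb h).sub (hb (h + 1))))).congr
    fun p hp c _ => ?_
  have : ∀ b u : ℤ, propInd ((p : ℤ) ^ g ∣ p * u * (b - c)) =
      propInd ((p : ℤ) ^ g ∣ u * (p * (b - c))) := fun b u => by congr 2; ring
  simp only [pairCount, this, sum_Ico_propInd_dvd_mul hp, Finset.sum_add_distrib,
    ← Finset.mul_sum]
  congr 1
  rw [Finset.sum_comm]
  simp only [← Finset.mul_sum, Finset.sum_sub_distrib]

/-- `F p c x` is a combination of the indicators of the conditions that `p ^ l` divides all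
`x s` with `s ∈ I`, with coefficients that are digit polynomials. -/
def IsLevelComb {ι : Type*} (E : ℕ) (I : Finset ι) (F : ℕ → ℕ → (ι → ℤ) → ℚ) : Prop :=
  ∃ (κ : Type) (_ : Fintype κ) (C : κ → ℕ → ℕ → ℚ) (lev : κ → ℕ),
    (∀ t, IsDigitPoly E (C t)) ∧ ∀ p : ℕ, p.Prime → ∀ c < p ^ E, ∀ x,
      F p c x = ∑ t, C t p c * propInd (∀ s ∈ I, (p : ℤ) ^ lev t ∣ x s)

namespace IsLevelComb

variable {ι : Type*} {E : ℕ} {I : Finset ι} {F F' : ℕ → ℕ → (ι → ℤ) → ℚ}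

theorem congr (hF : IsLevelComb E I F)
    (h : ∀ p : ℕ, p.Prime → ∀ c < p ^ E, ∀ x, F' p c x = F p c x) : IsLevelComb E I F' := by
  obtain ⟨κ, _, C, lev, hC, hF⟩ := hF
  exact ⟨κ, _, C, lev, hC, fun p hp c hc x => (h p hp c hc x).trans (hF p hp c hc x)⟩

theorem zero : IsLevelComb E I fun _ _ _ => 0 :=
  ⟨Empty, inferInstance, fun t => t.elim, fun t => t.elim, fun t => t.elim, by simp⟩

theorem propInd_dvd (l : ℕ) :
    IsLevelComb E I fun p _ x => propInd (∀ s ∈ I, (p : ℤ) ^ l ∣ x s) :=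
  ⟨Unit, inferInstance, fun _ _ _ => 1, fun _ => l, fun _ => IsDigitPoly.one E, by simp⟩

theorem add (hF : IsLevelComb E I F) (hF' : IsLevelComb E I F') :
    IsLevelComb E I fun p c x => F p c x + F' p c x := by
  obtain ⟨κ, _, C, lev, hC, hF⟩ := hF
  obtain ⟨κ', _, C', lev', hC', hF'⟩ := hF'
  refine ⟨κ ⊕ κ', inferInstance, Sum.elim C C', Sum.elim lev lev', ?_, fun p hp c hc x => ?_⟩
  · rintro (t | t)
    exacts [hC t, hC' t]
  · simp [hF p hp c hc x, hF' p hp c hc x, Fintype.sum_sum_type]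

theorem sum {κ : Type*} (S : Finset κ) {F : κ → ℕ → ℕ → (ι → ℤ) → ℚ}
    (hF : ∀ t, IsLevelComb E I (F t)) : IsLevelComb E I fun p c x => ∑ t ∈ S, F t p c x := by
  classical
  induction S using Finset.induction_on with
  | empty => simpa using zero
  | insert t S ht ih =>
    simp only [Finset.sum_insert ht]
    exact (hF t).add ih

theorem smul {f : ℕ → ℕ → ℚ} (hf : IsDigitPoly E f) (hF : IsLevelComb E I F) :
    IsLevelComb E I fun p c x => f p c * F p c x := by
  obtain ⟨κ, hκ, C, lev, hC, hF⟩ := hF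
  refine ⟨κ, hκ, fun t p c => f p c * C t p c, lev, fun t => hf.mul (hC t),
    fun p hp c hc x => ?_⟩
  simp only [hF p hp c hc x, Finset.mul_sum, mul_assoc]

theorem sub (hF : IsLevelComb E I F) (hF' : IsLevelComb E I F') :
    IsLevelComb E I fun p c x => F p c x - F' p c x :=
  (hF.add (hF'.smul ((IsDigitPoly.zero E).sub (IsDigitPoly.one E)))).congr
    fun p _ c _ x => by ring

theorem propInd_dvd_mul (l : ℕ) (hF : IsLevelComb E I F) :
    IsLevelComb E I fun p c x => propInd (∀ s ∈ I, (p : ℤ) ^ l ∣ x s) * F p c x := by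
  obtain ⟨κ, hκ, C, lev, hC, hF⟩ := hF
  refine ⟨κ, hκ, C, fun t => max l (lev t), hC, fun p hp c hc x => ?_⟩
  simp only [hF p hp c hc x, Finset.mul_sum]
  refine Finset.sum_congr rfl fun t _ => ?_
  rw [mul_left_comm, ← propInd_and]
  congr 1
  refine propInd_congr ⟨fun h s hs => ?_, fun h => ⟨fun s hs => ?_, fun s hs => ?_⟩⟩
  · rcases max_choice l (lev t) with hm | hm <;> rw [hm]
    exacts [h.1 s hs, h.2 s hs]
  · exact (pow_dvd_pow _ (le_max_left _ _)).trans (h s hs)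
  · exact (pow_dvd_pow _ (le_max_right _ _)).trans (h s hs)

end IsLevelComb

section Count

variable {m : ℕ}

/-- The possible `r`-th rows of the parameter family. -/
noncomputable def rowBox (q : ℕ) (r i j : Fin m) : Finset (Fin m → ℤ) :=
  Fintype.piFinset fun s => if (r < s ∧ s ≤ i) ∨ s = j then Finset.Ico (0 : ℤ) q else {0}

theorem sum_rowBox (q : ℕ) {r i j : Fin m} (hri : r < i) (hij : i < j) (F : (Fin m → ℤ) → ℚ) :
    ∑ v ∈ rowBox q r i j, F v =
      ∑ b ∈ Finset.Ico (0 : ℤ) q, ∑ u ∈ Finset.Ico (0 : ℤ) q,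
        ∑ α ∈ Fintype.piFinset
          (fun s => if s ∈ Finset.Ioo r i then Finset.Ico (0 : ℤ) q else {0}),
          F (Function.update (Function.update α i u) j b) := by
  rw [rowBox, sum_piFinset_eq_sum_update _ j 0, if_pos (Or.inr rfl)]
  refine Finset.sum_congr rfl fun b _ => ?_
  rw [sum_piFinset_eq_sum_update _ i 0, Function.update_of_ne hij.ne,
    if_pos (Or.inl ⟨hri, le_rfl⟩)]
  refine Finset.sum_congr rfl fun u _ => Finset.sum_congr (congrArg _ ?_) fun _ _ => rfl
  funext s
  by_cases hs : s = i
  · subst hs; simp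
  by_cases hs' : s = j
  · subst hs'; simp [hs, hij.le]
  simp only [Function.update_of_ne hs, Function.update_of_ne hs', hs', or_false,
    Finset.mem_Ioo, lt_iff_le_and_ne (b := i), ne_eq, hs, not_false_eq_true, and_true]

/-- The integer that the diagonal entry must divide for a row to be solvable. -/
def rowValue (p c : ℕ) (r i j : Fin m) (x v : Fin m → ℤ) : ℤ :=
  p * v i * (v j - c) - ∑ s ∈ Finset.Ioo r i, v s * x s

theorem sum_rowBox_propInd {p : ℕ} (hp : p.Prime) (d l c : ℕ) {r i j : Fin m} (hri : r < i)
    (hij : i < j) (x : Fin m → ℤ) (hl : ∀ s ∈ Finset.Ioo r i, (p : ℤ) ^ l ∣ x s) :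
    ∑ v ∈ rowBox (p ^ d) r i j, propInd ((p : ℤ) ^ (d + l) ∣ rowValue p c r i j x v) =
      (p : ℚ) ^ (d * #(Finset.Ioo r i) - (d + l - (d + l))) * pairCount d (d + l) p c *
          propInd (∀ s ∈ Finset.Ioo r i, (p : ℤ) ^ (d + l) ∣ x s) +
        ∑ g ∈ range (d + l), (p : ℚ) ^ (d * #(Finset.Ioo r i) - (d + l - g)) *
          pairCount d g p c * (propInd (∀ s ∈ Finset.Ioo r i, (p : ℤ) ^ g ∣ x s) -
            propInd (∀ s ∈ Finset.Ioo r i, (p : ℤ) ^ (g + 1) ∣ x s)) := by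
  have hval : ∀ (b u : ℤ) (α : Fin m → ℤ),
      rowValue p c r i j x (Function.update (Function.update α i u) j b) =
        p * u * (b - c) - ∑ s ∈ Finset.Ioo r i, α s * x s := by
    intro b u α
    rw [rowValue, Function.update_self, Function.update_of_ne hij.ne, Function.update_self]
    congr 1
    refine Finset.sum_congr rfl fun s hs => ?_
    have hs := (Finset.mem_Ioo.mp hs).2
    rw [Function.update_of_ne (hs.trans hij).ne, Function.update_of_ne hs.ne]
  have key : ∀ g, (∀ s ∈ Finset.Ioo r i, (p : ℤ) ^ g ∣ x s) →
      (g = d + l ∨ g < d + l ∧ ¬∀ s ∈ Finset.Ioo r i, (p : ℤ) ^ (g + 1) ∣ x s) →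
      ∑ v ∈ rowBox (p ^ d) r i j, propInd ((p : ℤ) ^ (d + l) ∣ rowValue p c r i j x v) =
        (p : ℚ) ^ (d * #(Finset.Ioo r i) - (d + l - g)) * pairCount d g p c := by
    intro g hg h
    rw [sum_rowBox _ hri hij]
    simp only [hval, Nat.cast_pow,
      sum_piFinset_propInd_of_level hp (Finset.Ioo r i) d l x _ hl hg h, pairCount,
      Finset.mul_sum]
  exact eq_sum_of_level (fun g => ∀ s ∈ Finset.Ioo r i, (p : ℤ) ^ g ∣ x s)
    (fun g hg s hs => (pow_dvd_pow _ (by omega)).trans (hg s hs)) (by simp) (d + l)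
    (fun g => (p : ℚ) ^ (d * #(Finset.Ioo r i) - (d + l - g)) * pairCount d g p c) _
    (fun h => key _ h (Or.inl rfl)) (fun g hg h h' => key _ h (Or.inr ⟨hg, h'⟩))

/-- Solvability of the first `k` reduced equations, given the later unknowns. -/
def RowsSolvable (p : ℕ) (d : Fin m → ℕ) (i j : Fin m) (k : ℕ) (c : ℕ)
    (a : Fin m → Fin m → ℤ) (x : Fin m → ℤ) : Prop :=
  ∃ y : Fin m → ℤ, (∀ s : Fin m, k ≤ s → y s = x s) ∧
    ∀ r : Fin m, (r : ℕ) < k → (p : ℤ) ^ d r * y r = rowValue p c r i j y (a r)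

/-- The parameter families whose rows from the `k`-th on vanish. -/
noncomputable def rowsBelow (p : ℕ) (d : Fin m → ℕ) (i j : Fin m) (k : ℕ) (r : Fin m) :
    Finset (Fin m → ℤ) :=
  if (r : ℕ) < k then rowBox (p ^ d r) r i j else {0}

theorem rowsSolvable_succ {p : ℕ} (hp : p.Prime) (d : Fin m → ℕ) (i j r : Fin m) (c : ℕ)
    (a : Fin m → Fin m → ℤ) (v x : Fin m → ℤ) :
    RowsSolvable p d i j (r + 1) c (Function.update a r v) x ↔
      (p : ℤ) ^ d r ∣ rowValue p c r i j x v ∧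
        RowsSolvable p d i j r c a
          (Function.update x r (rowValue p c r i j x v / (p : ℤ) ^ d r)) := by
  have hp0 : (p : ℤ) ^ d r ≠ 0 := pow_ne_zero _ (by exact_mod_cast hp.ne_zero)
  have hval : ∀ y : Fin m → ℤ, (∀ s : Fin m, (r : ℕ) + 1 ≤ s → y s = x s) →
      rowValue p c r i j y v = rowValue p c r i j x v := by
    intro y hy
    rw [rowValue, rowValue]
    congr 1
    refine Finset.sum_congr rfl fun s hs => ?_
    rw [hy s (Finset.mem_Ioo.mp hs).1]
  constructor
  · rintro ⟨y, hy, h⟩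
    have hr := h r (Nat.lt_succ_self _)
    rw [Function.update_self, hval y hy] at hr
    refine ⟨⟨y r, hr.symm⟩, y, fun s hs => ?_, fun s hs => ?_⟩
    · by_cases hsr : s = r
      · subst hsr
        rw [Function.update_self, ← hr, Int.mul_ediv_cancel_left _ hp0]
      · rw [Function.update_of_ne hsr]
        exact hy s (by have := Fin.val_ne_of_ne hsr; omega)
    · have := h s (by omega)
      rwa [Function.update_of_ne (Fin.ne_of_lt hs)] at this
  · rintro ⟨hdv, y, hy, h⟩
    have hy' : ∀ s : Fin m, (r : ℕ) + 1 ≤ s → y s = x s := by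
      intro s hs
      have hsr : s ≠ r := by rintro rfl; omega
      rw [hy s (by omega), Function.update_of_ne hsr]
    refine ⟨y, hy', fun s hs => ?_⟩
    by_cases hsr : s = r
    · subst hsr
      rw [Function.update_self, hval y hy', hy s le_rfl, Function.update_self,
        Int.mul_ediv_cancel' hdv]
    · rw [Function.update_of_ne hsr]
      exact h s (by have := Fin.val_ne_of_ne hsr; omega)

theorem update_rowsBelow_succ (p : ℕ) (d : Fin m → ℕ) (i j r : Fin m) :
    Function.update (rowsBelow p d i j (r + 1)) r {0} = rowsBelow p d i j r := by
  funext s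
  by_cases hs : s = r
  · subst hs; simp [rowsBelow]
  · have := Fin.val_ne_of_ne hs
    have h : (s : ℕ) < r + 1 ↔ (s : ℕ) < r := by omega
    simp [rowsBelow, hs, h]

theorem sum_rowsBelow_succ {p : ℕ} (hp : p.Prime) (d : Fin m → ℕ) (i j r : Fin m) (c : ℕ)
    (x : Fin m → ℤ) :
    ∑ a ∈ Fintype.piFinset (rowsBelow p d i j (r + 1)),
        propInd (RowsSolvable p d i j (r + 1) c a x) =
      ∑ v ∈ rowBox (p ^ d r) r i j, propInd ((p : ℤ) ^ d r ∣ rowValue p c r i j x v) *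
        ∑ a ∈ Fintype.piFinset (rowsBelow p d i j r), propInd (RowsSolvable p d i j r c a
          (Function.update x r (rowValue p c r i j x v / (p : ℤ) ^ d r))) := by
  rw [sum_piFinset_eq_sum_update _ r 0, update_rowsBelow_succ,
    show rowsBelow p d i j (r + 1) r = rowBox (p ^ d r) r i j by simp [rowsBelow]]
  simp only [rowsSolvable_succ hp, propInd_and, Finset.mul_sum]

theorem propInd_dvd_mul_propInd_update {p : ℕ} (hp : p.Prime) (d l : ℕ) {r i : Fin m}
    (hri : r < i) (x : Fin m → ℤ) (z : ℤ) :
    propInd ((p : ℤ) ^ d ∣ z) *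
        propInd (∀ s ∈ Finset.Ico r i, (p : ℤ) ^ l ∣ Function.update x r (z / (p : ℤ) ^ d) s) =
      propInd (∀ s ∈ Finset.Ioo r i, (p : ℤ) ^ l ∣ x s) * propInd ((p : ℤ) ^ (d + l) ∣ z) := by
  have hp0 : (p : ℤ) ^ d ≠ 0 := pow_ne_zero _ (by exact_mod_cast hp.ne_zero)
  rw [← propInd_and, ← propInd_and]
  refine propInd_congr ?_
  rw [← Finset.Ioo_insert_left hri]
  simp only [Finset.forall_mem_insert, Function.update_self]
  have h : ∀ s ∈ Finset.Ioo r i, Function.update x r (z / (p : ℤ) ^ d) s = x s := fun s hs =>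
    Function.update_of_ne (Finset.mem_Ioo.mp hs).1.ne' _ _
  constructor
  · rintro ⟨⟨w, rfl⟩, h1, h2⟩
    rw [Int.mul_ediv_cancel_left _ hp0] at h1
    refine ⟨fun s hs => h s hs ▸ h2 s hs, ?_⟩
    rw [pow_add]
    exact mul_dvd_mul_left _ h1
  · rintro ⟨h2, w, rfl⟩
    rw [pow_add, mul_assoc]
    refine ⟨dvd_mul_right _ _, ?_, fun s hs => ?_⟩
    · rw [Int.mul_ediv_cancel_left _ hp0]
      exact dvd_mul_right _ _
    · rw [← mul_assoc, ← pow_add, h s hs]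
      exact h2 s hs

theorem isLevelComb_sum_rowsBelow (E : ℕ) (d : Fin m → ℕ) {i j : Fin m} (hij : i < j) (k : ℕ)
    (hk : k ≤ i) :
    IsLevelComb E (Finset.univ.filter fun s : Fin m => k ≤ s ∧ s < i) fun p c x =>
      ∑ a ∈ Fintype.piFinset (rowsBelow p d i j k),
        propInd (RowsSolvable p d i j k c a x) := by
  induction k with
  | zero =>
    refine (IsLevelComb.propInd_dvd 0).congr fun p _ c _ x => ?_
    have h : ∀ a, RowsSolvable p d i j 0 c a x := fun a => ⟨x, fun _ _ => rfl, by simp⟩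
    rw [propInd_of_true (by simp), Finset.sum_congr rfl fun a _ => propInd_of_true (h a)]
    simp [rowsBelow, Fintype.card_piFinset]
  | succ k ih =>
    obtain ⟨κ, _, C, lev, hC, hF⟩ := ih (by omega)
    obtain ⟨r, rfl⟩ : ∃ r : Fin m, (r : ℕ) = k := ⟨⟨k, by omega⟩, rfl⟩
    have hri : r < i := hk
    have hI : (Finset.univ.filter fun s : Fin m => (r : ℕ) ≤ s ∧ s < i) = Finset.Ico r i := by
      ext s; simp
    have hI' : (Finset.univ.filter fun s : Fin m => (r : ℕ) + 1 ≤ s ∧ s < i) =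
        Finset.Ioo r i := by
      ext s; simp
    rw [hI] at hF
    rw [hI']
    have hrep : ∀ l, IsLevelComb E (Finset.Ioo r i) fun p c x =>
        (p : ℚ) ^ (d r * #(Finset.Ioo r i) - (d r + l - (d r + l))) *
            pairCount (d r) (d r + l) p c *
            propInd (∀ s ∈ Finset.Ioo r i, (p : ℤ) ^ (d r + l) ∣ x s) +
          ∑ g ∈ range (d r + l), (p : ℚ) ^ (d r * #(Finset.Ioo r i) - (d r + l - g)) *
            pairCount (d r) g p c * (propInd (∀ s ∈ Finset.Ioo r i, (p : ℤ) ^ g ∣ x s) -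
              propInd (∀ s ∈ Finset.Ioo r i, (p : ℤ) ^ (g + 1) ∣ x s)) := fun l =>
      ((IsLevelComb.propInd_dvd _).smul
        ((IsDigitPoly.prime_pow E _).mul (isDigitPoly_pairCount E _ _))).add
      (IsLevelComb.sum _ fun g =>
        ((IsLevelComb.propInd_dvd _).sub (IsLevelComb.propInd_dvd _)).smul
          ((IsDigitPoly.prime_pow E _).mul (isDigitPoly_pairCount E _ _)))
    refine (IsLevelComb.sum Finset.univ fun t =>
      ((hrep (lev t)).propInd_dvd_mul (lev t)).smul (hC t)).congr fun p hp c hc x => ?_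
    rw [sum_rowsBelow_succ hp]
    simp only [hF p hp c hc, Finset.mul_sum]
    rw [Finset.sum_comm]
    refine Finset.sum_congr rfl fun t _ => ?_
    simp only [mul_left_comm (propInd _) (C t p c),
      propInd_dvd_mul_propInd_update hp _ _ hri, ← Finset.mul_sum]
    by_cases hl : ∀ s ∈ Finset.Ioo r i, (p : ℤ) ^ lev t ∣ x s
    · rw [sum_rowBox_propInd hp (d r) (lev t) c hri hij x hl]
    · simp only [propInd_of_false hl, zero_mul]
theorem assocMatrix_castSucc (p : ℕ) (e : Fin m → ℕ) (a : Fin m → Fin m → ℤ) (r s : Fin m) :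
    assocMatrix p e a r.castSucc s.castSucc =
      if r = s then (p : ℤ) ^ e s else if r < s then (p : ℤ) * a r s else 0 := by
  have := s.isLt
  simp [assocMatrix, this.ne, Fin.ext_iff]

theorem assocMatrix_last_castSucc (p : ℕ) (e : Fin m → ℕ) (a : Fin m → Fin m → ℤ) (s : Fin m) :
    assocMatrix p e a (Fin.last m) s.castSucc = 0 := by
  have := s.isLt
  simp [assocMatrix, this.ne, this.ne', (Fin.castSucc_lt_last s).not_gt]

theorem assocMatrix_apply_last (p : ℕ) (e : Fin m → ℕ) (a : Fin m → Fin m → ℤ)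
    (r : Fin (m + 1)) : assocMatrix p e a r (Fin.last m) = 1 := by
  simp [assocMatrix]

theorem sum_assocMatrix_castSucc_mul (p : ℕ) (e : Fin m → ℕ) (a : Fin m → Fin m → ℤ)
    (r : Fin m) (y : Fin m → ℤ) :
    ∑ s : Fin m, assocMatrix p e a r.castSucc s.castSucc * y s =
      (p : ℤ) ^ e r * y r + p * ∑ s ∈ Finset.Ioi r, a r s * y s := by
  have h : ∀ s : Fin m, assocMatrix p e a r.castSucc s.castSucc * y s =
      (if r = s then (p : ℤ) ^ e s * y s else 0) +
        if s ∈ Finset.Ioi r then (p : ℤ) * (a r s * y s) else 0 := by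
    intro s
    simp only [assocMatrix_castSucc, Finset.mem_Ioi]
    rcases lt_trichotomy r s with hs | rfl | hs
    · simp [hs, hs.ne, mul_assoc]
    · simp
    · simp [hs.not_gt, hs.ne']
  simp only [h, Finset.sum_add_distrib, Finset.sum_ite_eq, Finset.mem_univ, if_true,
    Finset.sum_ite_mem, Finset.univ_inter, Finset.mul_sum]

theorem exists_mulVec_eq_iff_rowsSolvable {p : ℕ} (hp : p.Prime) (e : Fin m → ℕ)
    (he : ∀ r, 0 < e r) {i j : Fin m} (hij : i < j) (a : Fin m → Fin m → ℤ)
    (ha : ∀ r s : Fin m,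
      ¬(((r : ℕ) < (s : ℕ) ∧ (s : ℕ) ≤ (i : ℕ)) ∨ (s = j ∧ (r : ℕ) ≤ (i : ℕ))) → a r s = 0)
    (c : ℕ) (hc : a i j = c) :
    (∃ x : Fin (m + 1) → ℤ, (assocMatrix p e a).mulVec x =
      fun t => assocMatrix p e a t i.castSucc * assocMatrix p e a t j.castSucc) ↔
    RowsSolvable p (fun r => e r - 1) i j i c a 0 := by
  have hp0 : (p : ℤ) ≠ 0 := by exact_mod_cast hp.ne_zero
  have hpe : ∀ r, (p : ℤ) ^ e r = p * (p : ℤ) ^ (e r - 1) := fun r => by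
    rw [← pow_succ', Nat.sub_add_cancel (he r)]
  have hsum : ∀ (y : Fin m → ℤ) (r : Fin m), r < i → (∀ s, i < s → y s = 0) →
      ∑ s ∈ Finset.Ioi r, a r s * y s = a r i * y i + ∑ s ∈ Finset.Ioo r i, a r s * y s := by
    intro y r hr hy
    rw [← Finset.sum_insert (f := fun s => a r s * y s) (by simp), Finset.Ioo_insert_right hr]
    refine (Finset.sum_subset (fun s hs => ?_) fun s hs hs' => ?_).symm
    · exact Finset.mem_Ioi.mpr (Finset.mem_Ioc.mp hs).1
    · simp only [Finset.mem_Ioi, Finset.mem_Ioc, not_and, not_le] at hs hs'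
      rw [hy s (hs' hs), mul_zero]
  have hsum0 : ∀ (y : Fin m → ℤ) (r : Fin m), i ≤ r → (∀ s, i < s → y s = 0) →
      ∑ s ∈ Finset.Ioi r, a r s * y s = 0 := by
    intro y r hr hy
    refine Finset.sum_eq_zero fun s hs => ?_
    rw [hy s (hr.trans_lt (Finset.mem_Ioi.mp hs)), mul_zero]
  have hw : ∀ r : Fin m, assocMatrix p e a r.castSucc i.castSucc *
      assocMatrix p e a r.castSucc j.castSucc =
        if r < i then p * a r i * (p * a r j)
        else if r = i then (p : ℤ) ^ e i * (p * c) else 0 := by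
    intro r
    rw [assocMatrix_castSucc, assocMatrix_castSucc]
    rcases lt_trichotomy r i with hr | rfl | hr
    · simp [hr, hr.ne, hr.trans hij, (hr.trans hij).ne]
    · simp [hij, hij.ne, hc]
    · simp [hr.not_gt, hr.ne']
  constructor
  · rintro ⟨x, hx⟩
    have hlast := congrFun hx (Fin.last m)
    simp only [Matrix.mulVec, dotProduct, Fin.sum_univ_castSucc, assocMatrix_last_castSucc,
      assocMatrix_apply_last, zero_mul, Finset.sum_const_zero, zero_add, one_mul] at hlast
    have hrow : ∀ r : Fin m, (p : ℤ) ^ e r * x r.castSucc +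
        p * ∑ s ∈ Finset.Ioi r, a r s * x s.castSucc =
          if r < i then p * a r i * (p * a r j)
          else if r = i then (p : ℤ) ^ e i * (p * c) else 0 := by
      intro r
      have h := congrFun hx r.castSucc
      simp only [Matrix.mulVec, dotProduct, Fin.sum_univ_castSucc,
        assocMatrix_apply_last, hlast, mul_zero, add_zero, hw] at h
      rw [← h, sum_assocMatrix_castSucc_mul p e a r fun s => x s.castSucc]
    have hzero : ∀ s : Fin m, i < s → x s.castSucc = 0 := by
      intro s hs
      have h := hrow s
      have h0 : ∑ t ∈ Finset.Ioi s, a s t * x t.castSucc = 0 := by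
        refine Finset.sum_eq_zero fun t _ => ?_
        rw [ha s t (by have := Fin.lt_def.mp hs; omega), zero_mul]
      rw [h0, mul_zero, add_zero, if_neg hs.not_gt, if_neg hs.ne'] at h
      exact (mul_eq_zero.mp h).resolve_left (pow_ne_zero _ hp0)
    have hxi : x i.castSucc = p * c := by
      have h := hrow i
      rw [hsum0 (fun s => x s.castSucc) i le_rfl hzero, mul_zero, add_zero,
        if_neg (lt_irrefl i), if_pos rfl] at h
      exact mul_left_cancel₀ (pow_ne_zero _ hp0) h
    refine ⟨fun s => if s < i then x s.castSucc else 0, fun s hs => ?_, fun r hr => ?_⟩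
    · exact if_neg (not_lt.mpr hs)
    · have hr : r < i := hr
      have h := hrow r
      rw [hsum (fun s => x s.castSucc) r hr hzero, if_pos hr, hxi, hpe] at h
      have h2 : ∑ s ∈ Finset.Ioo r i, a r s * (if s < i then x s.castSucc else 0) =
          ∑ s ∈ Finset.Ioo r i, a r s * x s.castSucc :=
        Finset.sum_congr rfl fun s hs => by rw [if_pos (Finset.mem_Ioo.mp hs).2]
      simp only [rowValue, h2, if_pos hr]
      refine mul_left_cancel₀ hp0 ?_
      linear_combination h
  · rintro ⟨y, hy, h⟩
    let x' : Fin m → ℤ := fun s => if s < i then y s else if s = i then p * c else 0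
    have hx' : ∀ s, i < s → x' s = 0 := fun s hs => by simp [x', hs.not_gt, hs.ne']
    have hx'i : x' i = p * c := by simp [x']
    refine ⟨Fin.snoc (α := fun _ => ℤ) x' 0, funext fun t => ?_⟩
    simp only [Matrix.mulVec, dotProduct, Fin.sum_univ_castSucc, Fin.snoc_castSucc,
      Fin.snoc_last, mul_zero, add_zero]
    induction t using Fin.lastCases with
    | last => simp [assocMatrix_last_castSucc]
    | cast r =>
      rw [sum_assocMatrix_castSucc_mul, hw]
      rcases lt_trichotomy r i with hr | rfl | hr
      · have h1 := h r hr
        have h2 : ∑ s ∈ Finset.Ioo r i, a r s * x' s = ∑ s ∈ Finset.Ioo r i, a r s * y s :=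
          Finset.sum_congr rfl fun s hs => by simp only [x', if_pos (Finset.mem_Ioo.mp hs).2]
        have h3 : x' r = y r := if_pos hr
        rw [hsum x' r hr hx', h2, h3, hx'i, if_pos hr, hpe]
        rw [rowValue] at h1
        linear_combination (p : ℤ) * h1
      · rw [hsum0 x' r le_rfl hx', hx'i]
        simp
      · rw [hsum0 x' r hr.le hx', hx' r hr]
        simp [hr.not_gt, hr.ne']

theorem mem_piFinset_rowsBelow_succ {p : ℕ} (hp : p.Prime) (d : Fin m → ℕ) {i j : Fin m}
    (a : Fin m → Fin m → ℤ) :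
    a ∈ Fintype.piFinset (rowsBelow p d i j (i + 1)) ↔
      (∀ r s : Fin m, 0 ≤ a r s ∧ a r s < (p : ℤ) ^ d r) ∧
        ∀ r s : Fin m,
          ¬(((r : ℕ) < (s : ℕ) ∧ (s : ℕ) ≤ (i : ℕ)) ∨ (s = j ∧ (r : ℕ) ≤ (i : ℕ))) →
            a r s = 0 := by
  have hpos : ∀ r, (0 : ℤ) < (p : ℤ) ^ d r := fun r => by have := hp.pos; positivity
  rw [Fintype.mem_piFinset, ← forall_and]
  refine forall_congr' fun r => ?_
  rw [← forall_and, rowsBelow]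
  split_ifs with hr
  · rw [rowBox, Fintype.mem_piFinset]
    refine forall_congr' fun s => ?_
    have hr' : (r : ℕ) ≤ i := by omega
    simp only [Fin.lt_def, Fin.le_def, hr', and_true]
    split_ifs with h
    · rw [Finset.mem_Ico, Nat.cast_pow]
      exact ⟨fun h0 => ⟨h0, fun hn => absurd h hn⟩, fun h0 => h0.1⟩
    · simp only [Finset.mem_singleton, h, not_false_eq_true, true_implies]
      exact ⟨fun h0 => ⟨by simp [h0, hpos r], h0⟩, fun h0 => h0.2⟩
  · rw [Finset.mem_singleton]
    constructor
    · rintro h s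
      simp [h, hpos r]
    · intro h
      funext s
      exact (h s).2 (by omega)

theorem sum_rowBox_self (q : ℕ) {i j : Fin m} (F : (Fin m → ℤ) → ℚ) :
    ∑ v ∈ rowBox q i i j, F v = ∑ c ∈ range q, F (Function.update 0 j (c : ℤ)) := by
  have h : (Function.update (fun s : Fin m =>
      if (i < s ∧ s ≤ i) ∨ s = j then Finset.Ico (0 : ℤ) q else {0}) j {0}) = fun _ => {0} := by
    funext s
    by_cases hs : s = j
    · subst hs; simp
    · simp only [Function.update_of_ne hs, hs, or_false]
      exact if_neg fun h => h.1.not_ge h.2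
  rw [rowBox, sum_piFinset_eq_sum_update _ j 0, if_pos (Or.inr rfl), h]
  have h0 : (Fintype.piFinset fun _ : Fin m => ({0} : Finset ℤ)) = {0} :=
    Fintype.piFinset_singleton _
  simp only [h0, Finset.sum_singleton]
  refine Finset.sum_nbij' Int.toNat (fun c => (c : ℤ)) ?_ ?_ ?_ ?_ ?_
  · intro c hc
    simp only [Finset.mem_Ico, Finset.mem_range] at hc ⊢
    omega
  · intro c hc
    simpa using hc
  · intro c hc
    simp only [Finset.mem_Ico] at hc
    omega
  · intro c _
    simp
  · intro c hc
    simp only [Finset.mem_Ico] at hc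
    rw [Int.toNat_of_nonneg hc.1]

theorem rowsSolvable_update (p : ℕ) (d : Fin m → ℕ) (i j : Fin m) (c : ℕ)
    (a : Fin m → Fin m → ℤ) (v x : Fin m → ℤ) :
    RowsSolvable p d i j i c (Function.update a i v) x ↔ RowsSolvable p d i j i c a x := by
  refine exists_congr fun y => and_congr_right fun _ => forall₂_congr fun r hr => ?_
  rw [Function.update_of_ne (Fin.ne_of_lt hr)]

end Count

/-- The `vᵢ ∘ vⱼ` analogue of Proposition `vivi_poly`: fix `n = m+1 ≥ 2`, positive
integers `e₁, …, e_m`, and indices `i < j ≤ m`.  For each prime `p`, the number of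
tuples `(a_{rs})` indexed by `{(r,s) : r < s ≤ i} ∪ {(r,j) : r ≤ i}` with
`0 ≤ a_{rs} < p^{e_r - 1}` such that `vᵢ ∘ vⱼ` lies in the `ℤ`-span of the columns of
the associated matrix `A` is a polynomial in `p` (tuples are modeled as families
`a : Fin m → Fin m → ℤ` vanishing outside the index set). -/
theorem count_vivj_polynomial (m : ℕ) (hm : 1 ≤ m) (e : Fin m → ℕ)
    (he : ∀ r, 0 < e r) (i j : Fin m) (hij : i < j) :
    ∃ P : Polynomial ℚ, ∀ p : ℕ, p.Prime →
      (Nat.card {a : Fin m → Fin m → ℤ //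
        (∀ r s : Fin m, 0 ≤ a r s ∧ a r s < (p : ℤ) ^ (e r - 1)) ∧
        (∀ r s : Fin m,
          ¬(((r : ℕ) < (s : ℕ) ∧ (s : ℕ) ≤ (i : ℕ)) ∨ (s = j ∧ (r : ℕ) ≤ (i : ℕ))) →
            a r s = 0) ∧
        (∃ x : Fin (m + 1) → ℤ, (assocMatrix p e a).mulVec x =
          fun t => assocMatrix p e a t i.castSucc * assocMatrix p e a t j.castSucc)} : ℚ)
        = P.eval (p : ℚ) := by
  obtain ⟨κ, _, C, lev, hC, hF⟩ :=
    isLevelComb_sum_rowsBelow (e i - 1) (fun r => e r - 1) hij i le_rfl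
  obtain ⟨P, hP⟩ := (IsDigitPoly.sum Finset.univ hC).exists_sum_eq_eval
  refine ⟨P, fun p hp => ?_⟩
  rw [← hP p hp]
  classical
  rw [Nat.subtype_card ((Fintype.piFinset (rowsBelow p (fun r => e r - 1) i j (i + 1))).filter
    fun a => ∃ x : Fin (m + 1) → ℤ, (assocMatrix p e a).mulVec x =
      fun t => assocMatrix p e a t i.castSucc * assocMatrix p e a t j.castSucc) fun a => by
    rw [Finset.mem_filter, mem_piFinset_rowsBelow_succ hp _, and_assoc]]
  have hind : ∀ a ∈ Fintype.piFinset (rowsBelow p (fun r => e r - 1) i j (i + 1)),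
      (if ∃ x : Fin (m + 1) → ℤ, (assocMatrix p e a).mulVec x =
        fun t => assocMatrix p e a t i.castSucc * assocMatrix p e a t j.castSucc
        then (1 : ℚ) else 0) =
      propInd (RowsSolvable p (fun r => e r - 1) i j i (a i j).toNat a 0) := by
    intro a ha
    have ha := (mem_piFinset_rowsBelow_succ hp _ a).mp ha
    rw [← propInd_congr (exists_mulVec_eq_iff_rowsSolvable hp e he hij a ha.2 (a i j).toNat
      (Int.toNat_of_nonneg (ha.1 i j).1).symm), propInd]
  rw [Finset.card_filter]
  push_cast
  rw [Finset.sum_congr rfl hind, sum_piFinset_eq_sum_update _ i 0, update_rowsBelow_succ,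
    show rowsBelow p (fun r => e r - 1) i j (i + 1) i = rowBox (p ^ (e i - 1)) i i j by
      simp [rowsBelow], sum_rowBox_self]
  refine Finset.sum_congr rfl fun c hc => ?_
  simp only [Function.update_self, Int.toNat_natCast, rowsSolvable_update]
  refine (hF p hp c (Finset.mem_range.mp hc) 0).trans ?_
  refine Finset.sum_congr rfl fun t _ => ?_
  rw [propInd_of_true fun s hs => ?_, mul_one]
  have := (Finset.mem_filter.mp hs).2
  exact absurd this.2 (not_lt.mpr this.1)
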